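/- arXiv:1503.02478 — 2 statements merged into one kernel-verified Lean document; each statement's English description precedes it below -/
import Mathlib

section
/- There exist constants C_a > 0 and C₂ > 0 such that for every measurable V : ℝ → ℂ with ∫_ℝ (1+x²)·|V(x)| dx < ∞ and every z ∈ ℂ∖Σ: (i) ∫_ℝ∫_ℝ |V(x)|·|R_z(x,y)|²·|V(y)| dx dy ≤ max( C_a·(∫_ℝ (1+x²)|V(x)| dx)², C₂·Re z·(∫_ℝ |V(x)| dx)² ); and (ii) if moreover z ∉ 𝒮, then ∫_ℝ∫_ℝ |V(x)|·|R_z(x,y)|²·|V(y)| dx dy ≤ C_a·(∫_ℝ (1+x²)|V(x)| dx)². -/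
open MeasureTheory Complex Set

noncomputable def kp (z : ℂ) : ℂ := (Complex.I - z) ^ (1/2 : ℂ)
noncomputable def km (z : ℂ) : ℂ := (-Complex.I - z) ^ (1/2 : ℂ)

def SigmaSet : Set ℂ := {z : ℂ | 0 ≤ z.re ∧ (z.im = 1 ∨ z.im = -1)}

def Sset : Set ℂ := {z : ℂ | 0 ≤ z.re ∧ |z.im| < 1}

noncomputable def Rker (z : ℂ) (x y : ℝ) : ℂ :=
  if 0 ≤ x ∧ y ≤ 0 then Complex.exp (-(kp z) * (x : ℂ) + km z * (y : ℂ)) / (kp z + km z)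
  else if x ≤ 0 ∧ 0 ≤ y then Complex.exp (km z * (x : ℂ) - kp z * (y : ℂ)) / (kp z + km z)
  else if 0 ≤ x then
    Complex.exp (-(kp z) * (|x - y| : ℝ)) / (2 * kp z)
      + (kp z - km z) * Complex.exp (-(kp z) * ((x : ℂ) + (y : ℂ))) / (2 * kp z * (kp z + km z))
  else
    Complex.exp (-(km z) * (|x - y| : ℝ)) / (2 * km z)
      - (kp z - km z) * Complex.exp (km z * ((x : ℂ) + (y : ℂ))) / (2 * km z * (kp z + km z))

lemma sq_cpow_half (w : ℂ) : (w ^ (1/2 : ℂ)) ^ 2 = w := by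
  simp

lemma re_cpow_half_nonneg (w : ℂ) : 0 ≤ (w ^ (1/2 : ℂ)).re := by
  rw [one_div, Complex.cpow_inv_two_re]
  exact Real.sqrt_nonneg _

lemma kp_sq (z : ℂ) : kp z ^ 2 = Complex.I - z := sq_cpow_half _

lemma km_sq (z : ℂ) : km z ^ 2 = -Complex.I - z := sq_cpow_half _

lemma kp_re_nonneg (z : ℂ) : 0 ≤ (kp z).re := re_cpow_half_nonneg _

lemma km_re_nonneg (z : ℂ) : 0 ≤ (km z).re := re_cpow_half_nonneg _

lemma kp_ne_zero {z : ℂ} (hz : z ∉ SigmaSet) : kp z ≠ 0 := by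
  intro h
  have h2 := kp_sq z
  have hz' : z = Complex.I := by
    rw [h] at h2
    linear_combination h2
  exact hz (by simp [SigmaSet, hz'])

lemma km_ne_zero {z : ℂ} (hz : z ∉ SigmaSet) : km z ≠ 0 := by
  intro h
  have h2 := km_sq z
  have hz' : z = -Complex.I := by
    rw [h] at h2
    linear_combination h2
  exact hz (by simp [SigmaSet, hz'])

lemma kp_add_km_mul_kp_sub_km (z : ℂ) : (kp z + km z) * (kp z - km z) = 2 * Complex.I := by
  linear_combination kp_sq z - km_sq z

lemma kp_add_km_ne_zero (z : ℂ) : kp z + km z ≠ 0 := by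
  intro h
  have h2 := kp_add_km_mul_kp_sub_km z
  rw [h, zero_mul] at h2
  simp at h2

lemma norm_kp_add_km_mul_norm_kp_sub_km (z : ℂ) : ‖kp z + km z‖ * ‖kp z - km z‖ = 2 := by
  rw [← norm_mul, kp_add_km_mul_kp_sub_km]
  simp

/-- Off the strip, `kp z` and `km z` make an acute angle. -/
lemma inner_kp_km_nonneg {z : ℂ} (hz : z ∉ SigmaSet) (hS : z ∉ Sset) :
    0 ≤ (kp z).re * (km z).re + (kp z).im * (km z).im := by
  have hp := kp_sq z
  have hm := km_sq z
  have hp0 := kp_re_nonneg z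
  have hm0 := km_re_nonneg z
  have h1 := congrArg Complex.re hp
  have h2 := congrArg Complex.im hp
  have h3 := congrArg Complex.re hm
  have h4 := congrArg Complex.im hm
  simp only [sq, Complex.mul_re, Complex.mul_im, Complex.sub_re, Complex.sub_im, Complex.neg_re,
    Complex.neg_im, Complex.I_re, Complex.I_im] at h1 h2 h3 h4
  generalize (kp z).re = p at *
  generalize (kp z).im = q at *
  generalize (km z).re = r at *
  generalize (km z).im = s at *
  rcases lt_or_ge z.re 0 with hre | hre
  · have hq : |q| ≤ p := abs_le_of_sq_le_sq (by nlinarith) hp0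
    have hs : |s| ≤ r := abs_le_of_sq_le_sq (by nlinarith) hm0
    have h := mul_le_mul hq hs (abs_nonneg s) hp0
    rw [← abs_mul] at h
    linarith [neg_abs_le (q * s)]
  · have him : 1 < |z.im| := by
      by_contra! hle
      rcases hle.lt_or_eq with h | h
      · exact hS ⟨hre, h⟩
      · exact hz ⟨hre, eq_or_eq_neg_of_abs_eq h⟩
    have hpr : 0 ≤ p * r := mul_nonneg hp0 hm0
    rcases lt_abs.1 him with h | h
    · have hq : q ≤ 0 := by
        by_contra! hq
        nlinarith [mul_nonneg hp0 hq.le]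
      have hs : s ≤ 0 := by
        by_contra! hs
        nlinarith [mul_nonneg hm0 hs.le]
      linarith [mul_nonneg_of_nonpos_of_nonpos hq hs]
    · have hq : 0 ≤ q := by
        by_contra! hq
        nlinarith [mul_nonneg hp0 (neg_nonneg.2 hq.le)]
      have hs : 0 ≤ s := by
        by_contra! hs
        nlinarith [mul_nonneg hm0 (neg_nonneg.2 hs.le)]
      linarith [mul_nonneg hq hs]

lemma inv_norm_kp_add_km_sq (z : ℂ) : ‖kp z + km z‖⁻¹ ^ 2 = ‖kp z - km z‖ ^ 2 / 4 := by
  have h := norm_kp_add_km_mul_norm_kp_sub_km z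
  have h0 : ‖kp z + km z‖ ≠ 0 := norm_ne_zero_iff.2 (kp_add_km_ne_zero z)
  rw [inv_pow, inv_eq_iff_eq_inv, inv_div, eq_div_iff, ← mul_pow, h]
  · norm_num
  · have : ‖kp z - km z‖ ≠ 0 := right_ne_zero_of_mul (h.trans_ne two_ne_zero)
    positivity

lemma inv_norm_kp_add_km_sq_le_of_notMem_Sset {z : ℂ} (hz : z ∉ SigmaSet) (hS : z ∉ Sset) :
    ‖kp z + km z‖⁻¹ ^ 2 ≤ 3 := by
  have hi := inner_kp_km_nonneg hz hS
  have hle : ‖kp z - km z‖ ^ 2 ≤ ‖kp z + km z‖ ^ 2 := by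
    rw [Complex.sq_norm, Complex.sq_norm, Complex.normSq_apply, Complex.normSq_apply]
    simp only [Complex.sub_re, Complex.sub_im, Complex.add_re, Complex.add_im]
    nlinarith
  have hle' : ‖kp z - km z‖ ≤ ‖kp z + km z‖ := (sq_le_sq₀ (norm_nonneg _) (norm_nonneg _)).1 hle
  rw [inv_norm_kp_add_km_sq]
  nlinarith [norm_kp_add_km_mul_norm_kp_sub_km z,
    mul_le_mul_of_nonneg_right hle' (norm_nonneg (kp z - km z))]

lemma inv_norm_kp_add_km_sq_le_of_mem_Sset {z : ℂ} (hS : z ∈ Sset) :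
    ‖kp z + km z‖⁻¹ ^ 2 ≤ z.re + 2 := by
  have hz : ‖z‖ ≤ z.re + 1 := by
    have h := Complex.norm_le_abs_re_add_abs_im z
    rw [abs_of_nonneg hS.1] at h
    linarith [hS.2]
  have hp : ‖kp z‖ ^ 2 ≤ 1 + ‖z‖ := by
    rw [← norm_pow, kp_sq]
    simpa using norm_sub_le Complex.I z
  have hm : ‖km z‖ ^ 2 ≤ 1 + ‖z‖ := by
    rw [← norm_pow, km_sq]
    simpa using norm_sub_le (-Complex.I) z
  have h := pow_le_pow_left₀ (norm_nonneg _) (norm_sub_le (kp z) (km z)) 2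
  rw [inv_norm_kp_add_km_sq]
  nlinarith [sq_nonneg (‖kp z‖ - ‖km z‖)]

lemma one_le_norm_of_sq_eq {w a : ℂ} (h : a ^ 2 = w) (hw : w.re ≤ -1) : 1 ≤ ‖a‖ := by
  have h1 : 1 ≤ ‖a‖ ^ 2 := by
    rw [← norm_pow, h]
    linarith [Complex.abs_re_le_norm w, neg_abs_le w.re]
  exact (one_le_sq_iff₀ (norm_nonneg a)).1 h1

lemma norm_exp_sub_exp_le {u v : ℂ} (hu : u.re ≤ 0) (hv : v.re ≤ 0) :
    ‖Complex.exp v - Complex.exp u‖ ≤ ‖v - u‖ := by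
  have h := (convex_halfSpace_re_le 0).norm_image_sub_le_of_norm_hasDerivWithin_le
    (f := Complex.exp) (f' := Complex.exp) (C := 1)
    (fun x _ => (Complex.hasDerivAt_exp x).hasDerivWithinAt)
    (fun x hx => by
      rw [Complex.norm_exp]
      exact Real.exp_le_one_iff.2 hx) hu hv
  simpa using h

/-- The resolvent kernel of the half-line Dirichlet Laplacian, reflected evenly. -/
noncomputable def dirichletKernel (a : ℂ) (x y : ℝ) : ℂ :=
  (Complex.exp (-a * (|x - y| : ℝ)) - Complex.exp (-a * ((|x| + |y| : ℝ)))) / (2 * a)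

lemma norm_exp_neg_mul_le_one {a : ℂ} (ha : 0 ≤ a.re) {t : ℝ} (ht : 0 ≤ t) :
    ‖Complex.exp (-a * (t : ℂ))‖ ≤ 1 := by
  rw [Complex.norm_exp]
  refine Real.exp_le_one_iff.2 ?_
  simpa using mul_nonneg ha ht

lemma norm_dirichletKernel_le_abs {a : ℂ} (ha : 0 ≤ a.re) (ha0 : a ≠ 0) (x y : ℝ) :
    ‖dirichletKernel a x y‖ ≤ |x| := by
  have hpos : 0 < ‖a‖ := norm_pos_iff.2 ha0
  have h := norm_exp_sub_exp_le (u := -a * ((|x| + |y| : ℝ) : ℂ)) (v := -a * ((|x - y| : ℝ) : ℂ))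
    (by simpa using mul_nonneg ha (by positivity : 0 ≤ |x| + |y|))
    (by simpa using mul_nonneg ha (abs_nonneg (x - y)))
  rw [← mul_sub, ← Complex.ofReal_sub, norm_mul, norm_neg, Complex.norm_real,
    Real.norm_eq_abs] at h
  have h2 : |(|x - y| - (|x| + |y|))| ≤ 2 * |x| := by
    rw [abs_le]
    constructor <;> grind
  rw [dirichletKernel, norm_div, norm_mul, Complex.norm_two, div_le_iff₀ (by positivity)]
  nlinarith [mul_le_mul_of_nonneg_left h2 hpos.le]

lemma norm_dirichletKernel_le_one {a : ℂ} (ha : 0 ≤ a.re) (ha1 : 1 ≤ ‖a‖) (x y : ℝ) :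
    ‖dirichletKernel a x y‖ ≤ 1 := by
  have h1 := norm_exp_neg_mul_le_one ha (abs_nonneg (x - y))
  have h2 := norm_exp_neg_mul_le_one ha (by positivity : 0 ≤ |x| + |y|)
  rw [dirichletKernel, norm_div, norm_mul, Complex.norm_two, div_le_one (by positivity)]
  linarith [norm_sub_le (Complex.exp (-a * (|x - y| : ℝ)))
    (Complex.exp (-a * ((|x| + |y| : ℝ))))]

lemma norm_exp_div_le {u c : ℂ} (hu : u.re ≤ 0) : ‖Complex.exp u / c‖ ≤ ‖c‖⁻¹ := by
  rw [norm_div, Complex.norm_exp, div_eq_mul_inv]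
  exact mul_le_of_le_one_left (by positivity) (Real.exp_le_one_iff.2 hu)

lemma norm_Rker_le {z : ℂ} (hz : z ∉ SigmaSet) {x y m : ℝ}
    (hp : ‖dirichletKernel (kp z) x y‖ ≤ m) (hm : ‖dirichletKernel (km z) x y‖ ≤ m) :
    ‖Rker z x y‖ ≤ m + ‖kp z + km z‖⁻¹ := by
  have hm0 : 0 ≤ m := (norm_nonneg _).trans hp
  have ha := kp_re_nonneg z
  have hb := km_re_nonneg z
  have ha0 := kp_ne_zero hz
  have hb0 := km_ne_zero hz
  have hab := kp_add_km_ne_zero z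
  unfold Rker
  split_ifs with h1 h2 h3
  · refine (norm_exp_div_le ?_).trans (le_add_of_nonneg_left hm0)
    simp only [Complex.add_re, Complex.re_mul_ofReal, Complex.neg_re]
    nlinarith [mul_nonneg ha h1.1, mul_nonneg hb (neg_nonneg.2 h1.2)]
  · refine (norm_exp_div_le ?_).trans (le_add_of_nonneg_left hm0)
    simp only [Complex.sub_re, Complex.re_mul_ofReal]
    nlinarith [mul_nonneg ha h2.2, mul_nonneg hb (neg_nonneg.2 h2.1)]
  · have hy : 0 ≤ y := by grind
    have heq : Complex.exp (-(kp z) * (|x - y| : ℝ)) / (2 * kp z)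
        + (kp z - km z) * Complex.exp (-(kp z) * ((x : ℂ) + (y : ℂ)))
          / (2 * kp z * (kp z + km z))
        = dirichletKernel (kp z) x y
          + Complex.exp (-(kp z) * ((x + y : ℝ) : ℂ)) / (kp z + km z) := by
      rw [dirichletKernel, abs_of_nonneg h3, abs_of_nonneg hy]
      push_cast
      field_simp
      ring
    rw [heq]
    refine (norm_add_le _ _).trans (add_le_add hp (norm_exp_div_le ?_))
    rw [Complex.re_mul_ofReal, Complex.neg_re]
    nlinarith [mul_nonneg ha h3, mul_nonneg ha hy]
  · have hx : x ≤ 0 := by grind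
    have hy : y ≤ 0 := by grind
    have heq : Complex.exp (-(km z) * (|x - y| : ℝ)) / (2 * km z)
        - (kp z - km z) * Complex.exp (km z * ((x : ℂ) + (y : ℂ)))
          / (2 * km z * (kp z + km z))
        = dirichletKernel (km z) x y
          + Complex.exp (km z * ((x + y : ℝ) : ℂ)) / (kp z + km z) := by
      have he : -(km z) * ((-x + -y : ℝ) : ℂ) = km z * ((x : ℂ) + (y : ℂ)) := by
        push_cast
        ring
      rw [dirichletKernel, abs_of_nonpos hx, abs_of_nonpos hy, he]
      push_cast
      field_simp
      ring
    rw [heq]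
    refine (norm_add_le _ _).trans (add_le_add hm (norm_exp_div_le ?_))
    rw [Complex.re_mul_ofReal]
    nlinarith [mul_nonneg hb (neg_nonneg.2 hx), mul_nonneg hb (neg_nonneg.2 hy)]

lemma norm_Rker_sq_le_of_inv_le {z : ℂ} (hz : z ∉ SigmaSet) (h : ‖kp z + km z‖⁻¹ ^ 2 ≤ 3)
    (x y : ℝ) : ‖Rker z x y‖ ^ 2 ≤ 6 * ((1 + x ^ 2) * (1 + y ^ 2)) := by
  have hR := norm_Rker_le hz
    (norm_dirichletKernel_le_abs (kp_re_nonneg z) (kp_ne_zero hz) x y)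
    (norm_dirichletKernel_le_abs (km_re_nonneg z) (km_ne_zero hz) x y)
  have hR2 := pow_le_pow_left₀ (norm_nonneg _) hR 2
  nlinarith [sq_nonneg (|x| - ‖kp z + km z‖⁻¹), sq_abs x, sq_nonneg y, sq_nonneg x,
    mul_nonneg (sq_nonneg x) (sq_nonneg y)]

lemma norm_Rker_sq_le_re {z : ℂ} (hz : z ∉ SigmaSet) (hS : z ∈ Sset) (h1 : 1 ≤ z.re)
    (x y : ℝ) : ‖Rker z x y‖ ^ 2 ≤ 8 * z.re := by
  have hR := norm_Rker_le hz
    (norm_dirichletKernel_le_one (kp_re_nonneg z)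
      (one_le_norm_of_sq_eq (kp_sq z) (by simpa using h1)) x y)
    (norm_dirichletKernel_le_one (km_re_nonneg z)
      (one_le_norm_of_sq_eq (km_sq z) (by simpa using h1)) x y)
  have hR2 := pow_le_pow_left₀ (norm_nonneg _) hR 2
  nlinarith [sq_nonneg (1 - ‖kp z + km z‖⁻¹), inv_norm_kp_add_km_sq_le_of_mem_Sset hS]

lemma integral_integral_le_mul_sq {α : Type*} [MeasurableSpace α] {μ : Measure α} {f : α → ℝ}
    {F : α → α → ℝ} {K : ℝ} (hf : Integrable f μ) (hF0 : ∀ x y, 0 ≤ F x y)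
    (hF : ∀ x y, F x y ≤ K * (f x * f y)) :
    ∫ x, ∫ y, F x y ∂μ ∂μ ≤ K * (∫ x, f x ∂μ) ^ 2 := by
  have hin : ∀ x, ∫ y, F x y ∂μ ≤ K * (f x * ∫ y, f y ∂μ) := fun x => by
    rw [← integral_const_mul, ← integral_const_mul]
    exact integral_mono_of_nonneg (.of_forall (hF0 x)) ((hf.const_mul _).const_mul _)
      (.of_forall (hF x))
  calc ∫ x, ∫ y, F x y ∂μ ∂μ ≤ ∫ x, K * (f x * ∫ y, f y ∂μ) ∂μ :=
        integral_mono_of_nonneg (.of_forall fun x => integral_nonneg (hF0 x))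
          ((hf.mul_const _).const_mul _) (.of_forall hin)
    _ = K * (∫ x, f x ∂μ) ^ 2 := by
        rw [integral_const_mul, integral_mul_const, sq]

theorem stmt11 : ∃ Ca : ℝ, 0 < Ca ∧ ∃ C₂ : ℝ, 0 < C₂ ∧
    ∀ V : ℝ → ℂ, Measurable V →
      Integrable (fun x : ℝ => (1 + x ^ 2) * ‖V x‖) (volume : Measure ℝ) →
    ∀ z : ℂ, z ∉ SigmaSet →
      ((∫ x : ℝ, ∫ y : ℝ, ‖V x‖ * ‖Rker z x y‖ ^ 2 * ‖V y‖) ≤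
        max (Ca * (∫ x : ℝ, (1 + x ^ 2) * ‖V x‖) ^ 2)
          (C₂ * z.re * (∫ x : ℝ, ‖V x‖) ^ 2)) ∧
      (z ∉ Sset → (∫ x : ℝ, ∫ y : ℝ, ‖V x‖ * ‖Rker z x y‖ ^ 2 * ‖V y‖) ≤
        Ca * (∫ x : ℝ, (1 + x ^ 2) * ‖V x‖) ^ 2) := by
  refine ⟨6, by norm_num, 8, by norm_num, fun V hV hint z hz => ?_⟩
  have hV1 : Integrable (fun x => ‖V x‖) (volume : Measure ℝ) := by
    refine hint.mono' hV.norm.aestronglyMeasurable (.of_forall fun x => ?_)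
    rw [norm_norm]
    exact le_mul_of_one_le_left (norm_nonneg _) (by nlinarith [sq_nonneg x])
  have hF0 : ∀ x y : ℝ, 0 ≤ ‖V x‖ * ‖Rker z x y‖ ^ 2 * ‖V y‖ := fun x y => by positivity
  have key : ‖kp z + km z‖⁻¹ ^ 2 ≤ 3 →
      (∫ x : ℝ, ∫ y : ℝ, ‖V x‖ * ‖Rker z x y‖ ^ 2 * ‖V y‖) ≤
        6 * (∫ x : ℝ, (1 + x ^ 2) * ‖V x‖) ^ 2 := fun h => by
    refine integral_integral_le_mul_sq hint hF0 fun x y => ?_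
    have hR := mul_le_mul_of_nonneg_left (norm_Rker_sq_le_of_inv_le hz h x y)
      (by positivity : 0 ≤ ‖V x‖ * ‖V y‖)
    linarith
  have hout : z ∉ Sset → ‖kp z + km z‖⁻¹ ^ 2 ≤ 3 := inv_norm_kp_add_km_sq_le_of_notMem_Sset hz
  refine ⟨?_, fun hS => key (hout hS)⟩
  by_cases hS : z ∈ Sset
  · rcases le_total 1 z.re with h1 | h1
    · refine le_max_of_le_right (integral_integral_le_mul_sq hV1 hF0 fun x y => ?_)
      have hR := mul_le_mul_of_nonneg_left (norm_Rker_sq_le_re hz hS h1 x y)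
        (by positivity : 0 ≤ ‖V x‖ * ‖V y‖)
      linarith
    · exact le_max_of_le_left
        (key ((inv_norm_kp_add_km_sq_le_of_mem_Sset hS).trans (by linarith)))
  · exact le_max_of_le_left (key (hout hS))
end

section
/- There exists a constant k > 0 such that for every z ∈ 𝒮 with Re z ≥ 1 and every (x,y) ∈ ℝ², one has | R_z(x,y) − √(Re z)·e^{−i·√(Re z)·(x+y)} − (1/2)·e^{−i·√(Re z)·(x+y)}·( Im z·(x+y) − (|x|+|y|) ) | ≤ k·(1 + x² + y²)/√(Re z). -/
open MeasureTheory Complex Set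

/-- A complex number in the closed left half-plane satisfies a quadratic Taylor bound for `exp`. -/
lemma norm_exp_sub_one_sub_id_le_of_re_nonpos {w : ℂ} (hw : w.re ≤ 0) :
    ‖Complex.exp w - 1 - w‖ ≤ 3 * ‖w‖ ^ 2 := by
  rcases le_total ‖w‖ 1 with h | h
  · have := Complex.norm_exp_sub_one_sub_id_le h
    nlinarith [sq_nonneg ‖w‖]
  · have h1 : ‖Complex.exp w‖ ≤ 1 := by
      rw [Complex.norm_exp]
      exact Real.exp_le_one_iff.2 hw
    have h2 : ‖Complex.exp w - 1 - w‖ ≤ ‖Complex.exp w‖ + 1 + ‖w‖ := by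
      refine (norm_sub_le _ _).trans ?_
      have := norm_sub_le (Complex.exp w) 1
      rw [norm_one] at this
      linarith
    nlinarith

lemma cpow_half_sq (w : ℂ) : (w ^ (1 / 2 : ℂ)) ^ 2 = w := by
  rw [← Complex.cpow_nat_mul]
  norm_num

lemma cpow_half_re_nonneg (w : ℂ) : 0 ≤ (w ^ (1 / 2 : ℂ)).re := by
  rcases eq_or_ne w 0 with rfl | hw
  · simp
  · rw [Complex.cpow_def_of_ne_zero hw, Complex.exp_re]
    refine mul_nonneg (Real.exp_pos _).le (Real.cos_nonneg_of_mem_Icc ?_)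
    have him : (Complex.log w * (1 / 2 : ℂ)).im = Complex.arg w / 2 := by
      rw [show (1 / 2 : ℂ) = ((1 / 2 : ℝ) : ℂ) by push_cast; rfl, Complex.im_mul_ofReal,
        Complex.log_im]
      ring
    rw [him]
    constructor
    · linarith [Complex.neg_pi_lt_arg w]
    · linarith [Complex.arg_le_pi w]

/-- Expansion of a square root `a` of `-s² + j u` around `j s`, where `j² = -1`. -/
lemma sqrt_expansion {s u : ℝ} {a j : ℂ} (hs : 0 < s) (hu0 : 0 ≤ u) (hu2 : u ≤ 2)
    (hj : j ^ 2 = -1) (ha : a ^ 2 = -(s : ℂ) ^ 2 + j * u) (hlow : s ≤ ‖a + j * s‖) :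
    ‖a - j * s‖ ≤ 2 / s ∧ ‖(a - j * s) - (u : ℂ) / (2 * s)‖ ≤ 2 / s ^ 3 := by
  have hj1 : ‖j‖ = 1 := by
    have := congrArg norm hj
    rw [norm_pow, norm_neg, norm_one] at this
    exact (pow_eq_one_iff_of_nonneg (norm_nonneg j) two_ne_zero).1 this
  have hj0 : j ≠ 0 := by
    rintro rfl
    simp at hj1
  have hs0 : (s : ℂ) ≠ 0 := by exact_mod_cast hs.ne'
  have hprod : (a - j * s) * (a + j * s) = j * u := by
    linear_combination ha - (s : ℂ) ^ 2 * hj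
  have hnorm : ‖a - j * s‖ * ‖a + j * s‖ = u := by
    rw [← norm_mul, hprod, norm_mul, hj1, Complex.norm_real, Real.norm_of_nonneg hu0, one_mul]
  have h1 : ‖a - j * s‖ ≤ 2 / s := by
    rw [le_div_iff₀ hs]
    nlinarith [norm_nonneg (a - j * s)]
  refine ⟨h1, ?_⟩
  have hid : (a - j * s) - (u : ℂ) / (2 * s) = -(a - j * s) ^ 2 / (2 * j * s) := by
    field_simp
    linear_combination hprod
  rw [hid, norm_div, norm_neg, norm_pow, norm_mul, norm_mul, hj1, Complex.norm_real,
    Real.norm_of_nonneg hs.le, Complex.norm_ofNat]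
  calc ‖a - j * s‖ ^ 2 / (2 * 1 * s) ≤ (2 / s) ^ 2 / (2 * 1 * s) := by gcongr
    _ = 2 / s ^ 3 := by field_simp

/-- First-order expansion of an amplitude `c ≈ s` times a slowly decaying exponential. -/
lemma amplitude_mul_exp_expansion {s u v X Y : ℝ} {p q c : ℂ} (hs : 1 ≤ s)
    (hX : 0 ≤ X) (hY : 0 ≤ Y) (hp0 : 0 ≤ p.re) (hq0 : 0 ≤ q.re)
    (hp : ‖p‖ ≤ 2 / s) (hq : ‖q‖ ≤ 2 / s)
    (hp' : ‖p - (u : ℂ) / (2 * s)‖ ≤ 2 / s ^ 3) (hq' : ‖q - (v : ℂ) / (2 * s)‖ ≤ 2 / s ^ 3)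
    (hc : ‖c - s‖ ≤ 2 / s) :
    ‖c * Complex.exp (-p * X - q * Y) - s + (1 / 2) * ((u * X + v * Y : ℝ) : ℂ)‖
      ≤ 30 * (1 + X ^ 2 + Y ^ 2) / s := by
  have hs' : 0 < s := by linarith
  have hs0 : (s : ℂ) ≠ 0 := by exact_mod_cast hs'.ne'
  set w : ℂ := -p * X - q * Y with hw
  have hwre : w.re ≤ 0 := by
    simp only [hw, Complex.sub_re, Complex.neg_re, Complex.re_mul_ofReal]
    nlinarith [mul_nonneg hp0 hX, mul_nonneg hq0 hY]
  have hexp : ‖Complex.exp w‖ ≤ 1 := by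
    rw [Complex.norm_exp]
    exact Real.exp_le_one_iff.2 hwre
  have hwn : ‖w‖ ≤ 2 / s * (X + Y) := by
    refine (norm_sub_le _ _).trans ?_
    rw [norm_mul, norm_mul, norm_neg, Complex.norm_real, Complex.norm_real,
      Real.norm_of_nonneg hX, Real.norm_of_nonneg hY, mul_add]
    gcongr
  have hrem : ‖(p - (u : ℂ) / (2 * s)) * X + (q - (v : ℂ) / (2 * s)) * Y‖
      ≤ 2 / s ^ 3 * (X + Y) := by
    refine (norm_add_le _ _).trans ?_
    rw [norm_mul, norm_mul, Complex.norm_real, Complex.norm_real,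
      Real.norm_of_nonneg hX, Real.norm_of_nonneg hY, mul_add]
    gcongr
  have hid : c * Complex.exp w - s + (1 / 2) * ((u * X + v * Y : ℝ) : ℂ)
      = (c - s) * Complex.exp w + s * (Complex.exp w - 1 - w)
        - s * ((p - (u : ℂ) / (2 * s)) * X + (q - (v : ℂ) / (2 * s)) * Y) := by
    rw [hw]
    push_cast
    field_simp
    ring
  have hA : ‖(c - s) * Complex.exp w‖ ≤ 2 / s := by
    rw [norm_mul]
    calc _ ≤ 2 / s * 1 := by gcongr
      _ = 2 / s := mul_one _
  have hB : ‖s * (Complex.exp w - 1 - w)‖ ≤ 12 * (X + Y) ^ 2 / s := by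
    rw [norm_mul, Complex.norm_real, Real.norm_of_nonneg hs'.le]
    calc _ ≤ s * (3 * ‖w‖ ^ 2) := by
          gcongr
          exact norm_exp_sub_one_sub_id_le_of_re_nonpos hwre
      _ ≤ s * (3 * (2 / s * (X + Y)) ^ 2) := by gcongr
      _ = 12 * (X + Y) ^ 2 / s := by
        field_simp
        ring
  have hC : ‖s * ((p - (u : ℂ) / (2 * s)) * X + (q - (v : ℂ) / (2 * s)) * Y)‖
      ≤ 2 * (X + Y) / s := by
    rw [norm_mul, Complex.norm_real, Real.norm_of_nonneg hs'.le]
    calc _ ≤ s * (2 / s ^ 3 * (X + Y)) := by gcongr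
      _ = 2 * (X + Y) / s / s := by field_simp
      _ ≤ 2 * (X + Y) / s := div_le_self (by positivity) hs
  rw [hid]
  calc _ ≤ 2 / s + 12 * (X + Y) ^ 2 / s + 2 * (X + Y) / s :=
        (norm_sub_le _ _).trans (add_le_add ((norm_add_le _ _).trans (add_le_add hA hB)) hC)
    _ = (2 + 12 * (X + Y) ^ 2 + 2 * (X + Y)) / s := by ring
    _ ≤ 30 * (1 + X ^ 2 + Y ^ 2) / s := by
      gcongr
      nlinarith [sq_nonneg (X - Y), sq_nonneg (X - 1), sq_nonneg (Y - 1)]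

lemma le_norm_of_sq_eq {s : ℝ} {a : ℂ} (hs : 0 ≤ s) (ha : (a ^ 2).re = -s ^ 2) :
    s ≤ ‖a‖ := by
  have h := Complex.abs_re_le_norm (a ^ 2)
  rw [ha, abs_neg, abs_of_nonneg (sq_nonneg s), norm_pow] at h
  exact (sq_le_sq₀ hs (norm_nonneg a)).1 h

/-- An exponential with exponent in the closed left half-plane, divided by `2a`. -/
lemma norm_exp_div_two_mul_le {s : ℝ} {a w : ℂ} (hs : 0 < s) (ha : s ≤ ‖a‖) (hw : w.re ≤ 0) :
    ‖Complex.exp w / (2 * a)‖ ≤ 1 / (2 * s) := by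
  rw [norm_div, norm_mul, Complex.norm_ofNat, Complex.norm_exp]
  gcongr
  exact Real.exp_le_one_iff.2 hw

theorem stmt13 : ∃ k : ℝ, 0 < k ∧ ∀ z : ℂ, z ∈ Sset → 1 ≤ z.re → ∀ x y : ℝ,
    ‖Rker z x y - (Real.sqrt z.re : ℂ) * Complex.exp (-Complex.I * (Real.sqrt z.re : ℂ) * ((x : ℂ) + (y : ℂ)))
        - (1 / 2) * Complex.exp (-Complex.I * (Real.sqrt z.re : ℂ) * ((x : ℂ) + (y : ℂ))) *
          (((z.im * (x + y) : ℝ) : ℂ) - ((|x| + |y| : ℝ) : ℂ))‖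
      ≤ k * (1 + x ^ 2 + y ^ 2) / Real.sqrt z.re := by
  refine ⟨31, by norm_num, ?_⟩
  intro z hz hre x y
  obtain ⟨him1, him2⟩ := abs_lt.1 hz.2
  set s := Real.sqrt z.re with hsdef
  set t := z.im with ht
  have hs : 1 ≤ s := Real.one_le_sqrt.2 hre
  have hs' : 0 < s := by linarith
  have hs2 : s ^ 2 = z.re := Real.sq_sqrt (by linarith)
  have hzs : z = (s : ℂ) ^ 2 + t * Complex.I := by
    rw [← Complex.ofReal_pow, hs2, ht, Complex.re_add_im]
  set a := kp z with ha
  set b := km z with hb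
  have ha2 : a ^ 2 = -(s : ℂ) ^ 2 + Complex.I * ((1 - t : ℝ) : ℂ) := by
    rw [ha, kp, cpow_half_sq, hzs]
    push_cast
    ring
  have hb2 : b ^ 2 = -(s : ℂ) ^ 2 + -Complex.I * ((1 + t : ℝ) : ℂ) := by
    rw [hb, km, cpow_half_sq, hzs]
    push_cast
    ring
  have ha0 : 0 ≤ a.re := cpow_half_re_nonneg _
  have hb0 : 0 ≤ b.re := cpow_half_re_nonneg _
  have hare : (a ^ 2).re = -s ^ 2 := by
    rw [ha2]
    simp [pow_two]
  have hbre : (b ^ 2).re = -s ^ 2 := by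
    rw [hb2]
    simp [pow_two]
  have haim : 0 ≤ a.im := by
    have h : (a ^ 2).im = 1 - t := by
      rw [ha2]
      simp [pow_two]
    rw [pow_two, Complex.mul_im] at h
    nlinarith
  have hbim : b.im ≤ 0 := by
    have h : (b ^ 2).im = -(1 + t) := by
      rw [hb2]
      simp [pow_two]
    rw [pow_two, Complex.mul_im] at h
    nlinarith
  have han : s ≤ ‖a‖ := le_norm_of_sq_eq hs'.le hare
  have hbn : s ≤ ‖b‖ := le_norm_of_sq_eq hs'.le hbre
  have halow : s ≤ ‖a + Complex.I * s‖ := by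
    refine le_trans ?_ ((le_abs_self _).trans (Complex.abs_im_le_norm _))
    simp
    linarith
  have hblow : s ≤ ‖b + -Complex.I * s‖ := by
    refine le_trans ?_ ((neg_le_abs _).trans (Complex.abs_im_le_norm _))
    simp
    linarith
  obtain ⟨hp, hp'⟩ := sqrt_expansion hs' (by linarith) (by linarith)
    Complex.I_sq ha2 halow
  obtain ⟨hq, hq'⟩ := sqrt_expansion hs' (by linarith) (by linarith)
    (by rw [neg_sq, Complex.I_sq]) hb2 hblow
  set p := a - Complex.I * s with hpdef
  set q := b - -Complex.I * s with hqdef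
  have hp0 : 0 ≤ p.re := by simpa [hpdef] using ha0
  have hq0 : 0 ≤ q.re := by simpa [hqdef] using hb0
  have ha_ne : a ≠ 0 := norm_pos_iff.1 (hs'.trans_le han)
  have hb_ne : b ≠ 0 := norm_pos_iff.1 (hs'.trans_le hbn)
  have hprod : (a - b) * (a + b) = 2 * Complex.I := by
    have : (a - b) * (a + b) = a ^ 2 - b ^ 2 := by ring
    rw [this, ha2, hb2]
    push_cast
    ring
  have hab : a + b ≠ 0 := by
    intro h
    rw [h, mul_zero] at hprod
    simp at hprod
  have hc : ‖(a + b)⁻¹ - s‖ ≤ 2 / s := by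
    have hid : (a + b)⁻¹ - s = (p - q) / (2 * Complex.I) := by
      have : (a + b)⁻¹ = (a - b) / (2 * Complex.I) := by
        rw [← hprod, inv_eq_one_div, div_eq_div_iff hab
          (by rw [hprod]; simp)]
        ring
      rw [this, hpdef, hqdef]
      field_simp
      ring
    rw [hid, norm_div, norm_mul, Complex.norm_I, Complex.norm_ofNat, mul_one,
      div_le_iff₀ two_pos]
    linarith [norm_sub_le p q]
  have hphase : ‖Complex.exp (-Complex.I * (s : ℂ) * ((x : ℂ) + (y : ℂ)))‖ = 1 := by
    rw [show -Complex.I * (s : ℂ) * ((x : ℂ) + (y : ℂ)) = ((-s * (x + y) : ℝ) : ℂ) * Complex.I by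
      push_cast
      ring, Complex.norm_exp_ofReal_mul_I]
  have hmain : ∀ (u v : ℝ) (p' q' E : ℂ), 0 ≤ p'.re → 0 ≤ q'.re → ‖p'‖ ≤ 2 / s → ‖q'‖ ≤ 2 / s →
      ‖p' - (u : ℂ) / (2 * s)‖ ≤ 2 / s ^ 3 → ‖q' - (v : ℂ) / (2 * s)‖ ≤ 2 / s ^ 3 →
      E = -Complex.I * (s : ℂ) * ((x : ℂ) + (y : ℂ)) + (-p' * (|x| : ℝ) - q' * (|y| : ℝ)) →
      t * (x + y) - (|x| + |y|) = -(u * |x| + v * |y|) →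
      ‖(a + b)⁻¹ * Complex.exp E
        - (s : ℂ) * Complex.exp (-Complex.I * (s : ℂ) * ((x : ℂ) + (y : ℂ)))
        - (1 / 2) * Complex.exp (-Complex.I * (s : ℂ) * ((x : ℂ) + (y : ℂ))) *
          (((t * (x + y) : ℝ) : ℂ) - ((|x| + |y| : ℝ) : ℂ))‖
      ≤ 30 * (1 + x ^ 2 + y ^ 2) / s := by
    intro u v p' q' E h1 h2 h3 h4 h5 h6 hE hL
    have h := amplitude_mul_exp_expansion hs (abs_nonneg x) (abs_nonneg y) h1 h2 h3 h4 h5 h6 hc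
    rw [sq_abs, sq_abs] at h
    refine le_trans (le_of_eq ?_) h
    rw [← Complex.ofReal_sub, hL, hE, Complex.exp_add, ← one_mul ‖_ - (s : ℂ) + _‖, ← hphase,
      ← norm_mul]
    congr 1
    push_cast
    ring
  have hextra : 1 / (2 * s) + 1 / (2 * s) ≤ 1 * (1 + x ^ 2 + y ^ 2) / s := by
    rw [show 1 / (2 * s) + 1 / (2 * s) = 1 / s by field_simp; norm_num]
    gcongr
    nlinarith [sq_nonneg x, sq_nonneg y]
  have hadd : 30 * (1 + x ^ 2 + y ^ 2) / s + 1 * (1 + x ^ 2 + y ^ 2) / s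
      = 31 * (1 + x ^ 2 + y ^ 2) / s := by ring
  have hweak : 30 * (1 + x ^ 2 + y ^ 2) / s ≤ 31 * (1 + x ^ 2 + y ^ 2) / s := by
    gcongr
    norm_num
  unfold Rker
  rw [← ha, ← hb]
  split_ifs with c1 c2 c3
  · obtain ⟨hx, hy⟩ := c1
    rw [div_eq_inv_mul]
    refine (hmain (1 - t) (1 + t) p q _ hp0 hq0 hp hq hp' hq' ?_ ?_).trans hweak
    · rw [abs_of_nonneg hx, abs_of_nonpos hy, hpdef, hqdef]
      push_cast
      ring
    · rw [abs_of_nonneg hx, abs_of_nonpos hy]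
      ring
  · obtain ⟨hx, hy⟩ := c2
    rw [div_eq_inv_mul]
    refine (hmain (1 + t) (1 - t) q p _ hq0 hp0 hq hp hq' hp' ?_ ?_).trans hweak
    · rw [abs_of_nonpos hx, abs_of_nonneg hy, hpdef, hqdef]
      push_cast
      ring
    · rw [abs_of_nonpos hx, abs_of_nonneg hy]
      ring
  · have hy : 0 ≤ y := by
      by_contra! hy
      exact c1 ⟨c3, hy.le⟩
    have h := hmain (1 - t) (1 - t) p p (-a * ((x : ℂ) + y)) hp0 hp0 hp hp hp' hp'
      (by
        rw [abs_of_nonneg c3, abs_of_nonneg hy, hpdef]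
        ring)
      (by
        rw [abs_of_nonneg c3, abs_of_nonneg hy]
        ring)
    have h1 : ‖Complex.exp (-a * (|x - y| : ℝ)) / (2 * a)‖ ≤ 1 / (2 * s) := by
      refine norm_exp_div_two_mul_le hs' han ?_
      rw [Complex.re_mul_ofReal, Complex.neg_re]
      nlinarith [mul_nonneg ha0 (abs_nonneg (x - y))]
    have h2 : ‖Complex.exp (-a * ((x : ℂ) + y)) / (2 * a)‖ ≤ 1 / (2 * s) := by
      refine norm_exp_div_two_mul_le hs' han ?_
      rw [← Complex.ofReal_add, Complex.re_mul_ofReal, Complex.neg_re]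
      nlinarith [mul_nonneg ha0 (add_nonneg c3 hy)]
    have hcoef : (a - b) * Complex.exp (-a * ((x : ℂ) + y)) / (2 * a * (a + b))
        = (a + b)⁻¹ * Complex.exp (-a * ((x : ℂ) + y))
          - Complex.exp (-a * ((x : ℂ) + y)) / (2 * a) := by
      field_simp
      ring
    rw [hcoef, ← hadd]
    refine le_trans ?_ (add_le_add h ((add_le_add h1 h2).trans hextra))
    refine le_trans (le_of_eq ?_) ((norm_add_le _ _).trans (add_le_add_right (norm_sub_le _ _) _))
    congr 1
    ring
  · have hx : x ≤ 0 := (not_le.1 c3).le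
    have hy : y ≤ 0 := by
      by_contra! hy
      exact c2 ⟨hx, hy.le⟩
    have h := hmain (1 + t) (1 + t) q q (b * ((x : ℂ) + y)) hq0 hq0 hq hq hq' hq'
      (by
        rw [abs_of_nonpos hx, abs_of_nonpos hy, hqdef]
        push_cast
        ring)
      (by
        rw [abs_of_nonpos hx, abs_of_nonpos hy]
        ring)
    have h1 : ‖Complex.exp (-b * (|x - y| : ℝ)) / (2 * b)‖ ≤ 1 / (2 * s) := by
      refine norm_exp_div_two_mul_le hs' hbn ?_
      rw [Complex.re_mul_ofReal, Complex.neg_re]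
      nlinarith [mul_nonneg hb0 (abs_nonneg (x - y))]
    have h2 : ‖Complex.exp (b * ((x : ℂ) + y)) / (2 * b)‖ ≤ 1 / (2 * s) := by
      refine norm_exp_div_two_mul_le hs' hbn ?_
      rw [← Complex.ofReal_add, Complex.re_mul_ofReal]
      exact mul_nonpos_of_nonneg_of_nonpos hb0 (add_nonpos hx hy)
    have hcoef : (a - b) * Complex.exp (b * ((x : ℂ) + y)) / (2 * b * (a + b))
        = Complex.exp (b * ((x : ℂ) + y)) / (2 * b)
          - (a + b)⁻¹ * Complex.exp (b * ((x : ℂ) + y)) := by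
      field_simp
      ring
    rw [hcoef, ← hadd]
    refine le_trans ?_ (add_le_add h ((add_le_add h1 h2).trans hextra))
    refine le_trans (le_of_eq ?_) ((norm_add_le _ _).trans (add_le_add_right (norm_sub_le _ _) _))
    congr 1
    ring
end
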